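/- arXiv:1410.7086 — 5 statements merged into one kernel-verified Lean document; each statement's English description precedes it below -/
import Mathlib

section
/- Let p, q ∈ ℂ with p ≠ q, and let γ : [0,1] → ℂ be a continuous closed curve (γ(0) = γ(1)) whose image avoids both p and q. Assume that γ, regarded as a loop in ℂ \ {p}, is not null-homotopic, and that γ, regarded as a loop in ℂ \ {q}, is not null-homotopic. Then the Euclidean length of γ (its total variation) is at least 2·|p − q|. -/
open Set unitInterval

/-- A loop `γ : [0,1] → ℂ` (with `γ 0 = γ 1`) taking values in `A ⊆ ℂ` is null-homotopic in `A`
if there is a homotopy, relative to the endpoints, staying inside `A`, from `γ` to the constant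
loop at `γ 0`. -/
def NullHomotopicIn (γ : unitInterval → ℂ) (A : Set ℂ) : Prop :=
  ∃ H : C(unitInterval × unitInterval, ℂ),
    (∀ t, H (0, t) = γ t) ∧
    (∀ t, H (1, t) = γ 0) ∧
    (∀ s, H (s, 0) = γ 0) ∧
    (∀ s, H (s, 1) = γ 0) ∧
    (∀ x, H x ∈ A)

/-- A loop whose translate by `-p`, rotated by `w⁻¹`, stays in the slit plane is null-homotopic in
`ℂ \ {p}`: interpolate the principal logarithm linearly. -/
theorem nullHomotopicIn_compl_singleton_of_mem_slitPlane {p w : ℂ} (hw : w ≠ 0)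
    {γ : unitInterval → ℂ} (hγ : Continuous γ) (hclosed : γ 0 = γ 1)
    (hslit : ∀ t, (γ t - p) / w ∈ Complex.slitPlane) :
    NullHomotopicIn γ {p}ᶜ := by
  have hlog : Continuous fun t => Complex.log ((γ t - p) / w) :=
    Continuous.clog (by fun_prop) hslit
  have hexp (t : unitInterval) : p + w * Complex.exp (Complex.log ((γ t - p) / w)) = γ t := by
    rw [Complex.exp_log (Complex.slitPlane_ne_zero (hslit t))]
    field_simp
    ring
  have hconst (s : unitInterval) (z : ℂ) :
      (1 - ((s : ℝ) : ℂ)) * z + ((s : ℝ) : ℂ) * z = z := by ring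
  refine ⟨⟨fun x => p + w * Complex.exp ((1 - ((x.1 : ℝ) : ℂ)) * Complex.log ((γ x.2 - p) / w)
    + ((x.1 : ℝ) : ℂ) * Complex.log ((γ 0 - p) / w)), ?_⟩, ?_, ?_, ?_, ?_, ?_⟩
  · have := hlog.comp (continuous_snd (X := unitInterval) (Y := unitInterval))
    simp only [Function.comp_def] at this
    fun_prop
  · intro t
    simpa using hexp t
  · intro t
    simpa using hexp 0
  · intro s
    simpa only [ContinuousMap.coe_mk, hconst] using hexp 0
  · intro s
    simpa only [ContinuousMap.coe_mk, ← hclosed, hconst] using hexp 0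
  · intro x
    simp [hw, Complex.exp_ne_zero]

/-- A loop that is not null-homotopic in `ℂ \ {p}` meets every ray issuing from `p`. -/
theorem exists_eq_sub_mul_of_not_nullHomotopicIn {p w : ℂ} (hw : w ≠ 0)
    {γ : unitInterval → ℂ} (hγ : Continuous γ) (hclosed : γ 0 = γ 1)
    (hp : ¬ NullHomotopicIn γ {p}ᶜ) :
    ∃ t, ∃ r : ℝ, 0 ≤ r ∧ γ t = p - r * w := by
  obtain ⟨t, ht⟩ : ∃ t, (γ t - p) / w ∉ Complex.slitPlane := by
    by_contra! h
    exact hp (nullHomotopicIn_compl_singleton_of_mem_slitPlane hw hγ hclosed h)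
  rw [Complex.mem_slitPlane_iff] at ht
  push Not at ht
  refine ⟨t, -((γ t - p) / w).re, by linarith [ht.1], ?_⟩
  have hre : ((((γ t - p) / w).re : ℝ) : ℂ) = (γ t - p) / w :=
    Complex.ext (by simp) (by simp [ht.2])
  rw [Complex.ofReal_neg, hre]
  field_simp
  ring

/-- The length of a closed curve is at least twice the distance between any two of its points. -/
theorem two_mul_edist_le_eVariationOn_of_closed {E : Type*} [PseudoEMetricSpace E]
    {γ : unitInterval → E} (hclosed : γ 0 = γ 1) (a b : unitInterval) :
    2 * edist (γ a) (γ b) ≤ eVariationOn γ Set.univ := by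
  wlog hab : a ≤ b generalizing a b
  · rw [edist_comm]
    exact this b a (le_of_not_ge hab)
  have ha : (0 : unitInterval) ≤ a := unitInterval.nonneg'
  have hb : b ≤ (1 : unitInterval) := unitInterval.le_one'
  have hsplit : eVariationOn γ (Icc 0 a) + eVariationOn γ (Icc a b) + eVariationOn γ (Icc b 1)
      = eVariationOn γ Set.univ := by
    have h₁ := eVariationOn.Icc_add_Icc γ (s := Set.univ) ha hab (mem_univ a)
    have h₂ := eVariationOn.Icc_add_Icc γ (s := Set.univ) (ha.trans hab) hb (mem_univ b)
    simp only [univ_inter] at h₁ h₂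
    rw [h₁, h₂]
    congr 1
    exact eq_univ_of_forall fun t => ⟨unitInterval.nonneg', unitInterval.le_one'⟩
  have hout : edist (γ a) (γ b) ≤ eVariationOn γ (Icc 0 a) + eVariationOn γ (Icc b 1) :=
    calc edist (γ a) (γ b) ≤ edist (γ a) (γ 0) + edist (γ 0) (γ b) := edist_triangle _ _ _
      _ ≤ _ := add_le_add
        (eVariationOn.edist_le γ (right_mem_Icc.2 ha) (left_mem_Icc.2 ha))
        (hclosed ▸ eVariationOn.edist_le γ (right_mem_Icc.2 hb) (left_mem_Icc.2 hb))
  have hin : edist (γ a) (γ b) ≤ eVariationOn γ (Icc a b) :=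
    eVariationOn.edist_le γ (left_mem_Icc.2 hab) (right_mem_Icc.2 hab)
  calc 2 * edist (γ a) (γ b) = edist (γ a) (γ b) + edist (γ a) (γ b) := two_mul _
    _ ≤ eVariationOn γ (Icc 0 a) + eVariationOn γ (Icc b 1) + eVariationOn γ (Icc a b) :=
      add_le_add hout hin
    _ = eVariationOn γ Set.univ := by rw [← hsplit, add_right_comm]

/-- **A loop winding around two points has length at least `2|p − q|`.**
If a closed curve in `ℂ` avoids `p ≠ q` and is null-homotopic in neither `ℂ \ {p}` nor
`ℂ \ {q}`, then its Euclidean length (total variation) is at least `2·|p − q|`. -/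
theorem length_ge_of_not_nullhomotopic_two_points
    (p q : ℂ) (hpq : p ≠ q)
    (γ : unitInterval → ℂ) (hγ : Continuous γ) (hclosed : γ 0 = γ 1)
    (havoid : ∀ t, γ t ≠ p ∧ γ t ≠ q)
    (hp : ¬ NullHomotopicIn γ {p}ᶜ)
    (hq : ¬ NullHomotopicIn γ {q}ᶜ) :
    ENNReal.ofReal (2 * dist p q) ≤ eVariationOn γ Set.univ := by
  obtain ⟨a, r, hr, ha⟩ :=
    exists_eq_sub_mul_of_not_nullHomotopicIn (sub_ne_zero.2 hpq.symm) hγ hclosed hp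
  obtain ⟨b, s, hs, hb⟩ :=
    exists_eq_sub_mul_of_not_nullHomotopicIn (sub_ne_zero.2 hpq) hγ hclosed hq
  have hdist : dist p q ≤ dist (γ a) (γ b) := by
    have hsub : γ a - γ b = ((1 + r + s : ℝ) : ℂ) * (p - q) := by
      rw [ha, hb]
      push_cast
      ring
    rw [dist_eq_norm, dist_eq_norm, hsub, norm_mul, Complex.norm_of_nonneg (by positivity)]
    exact le_mul_of_one_le_left (norm_nonneg _) (by linarith)
  calc ENNReal.ofReal (2 * dist p q) ≤ ENNReal.ofReal (2 * dist (γ a) (γ b)) := by gcongr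
    _ = 2 * edist (γ a) (γ b) := by
      rw [ENNReal.ofReal_mul zero_le_two, edist_dist, ENNReal.ofReal_ofNat]
    _ ≤ eVariationOn γ Set.univ := two_mul_edist_le_eVariationOn_of_closed hclosed a b
end

section
/- Let Δ = {z ∈ ℂ : |z| < 1} be the open unit disc, let E ⊆ Δ be a compact subset containing two distinct points p and q, and let X = Δ \ E. Let r ∈ (0,1) be such that E ⊆ {z : |z| < r}, and let γ_r : [0,1] → X be the circle γ_r(t) = r·e^{2πit}. Then every loop γ' : [0,1] → X that is freely homotopic to γ_r within X has Euclidean length (total variation) at least 2·|p − q|. -/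
open Set unitInterval Real

/-- Two loops `γ, γ'` (maps `[0,1] → ℂ` with matching values at `0` and `1` along the homotopy)
with values in `A ⊆ ℂ` are freely homotopic in `A` if there is a continuous
`H : [0,1] × [0,1] → A` with `H (0, ·) = γ`, `H (1, ·) = γ'` and `H (s, 0) = H (s, 1)`
for all `s`. -/
def FreelyHomotopicIn (γ γ' : unitInterval → ℂ) (A : Set ℂ) : Prop :=
  ∃ H : C(unitInterval × unitInterval, ℂ),
    (∀ t, H (0, t) = γ t) ∧
    (∀ t, H (1, t) = γ' t) ∧
    (∀ s, H (s, 0) = H (s, 1)) ∧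
    (∀ x, H x ∈ A)

/-- Two continuous logarithms of the same function on a preconnected space differ by a constant. -/
theorem Complex.sub_eq_sub_of_exp_eq_exp {A : Type*} [TopologicalSpace A] [PreconnectedSpace A]
    {f g : A → ℂ} (hf : Continuous f) (hg : Continuous g)
    (h : ∀ a, Complex.exp (f a) = Complex.exp (g a)) (a b : A) : f a - g a = f b - g b := by
  have key := Complex.isCoveringMap_exp.eq_of_comp_eq hf (hg.add_const (f b - g b))
    (by
      ext x
      simp [Complex.exp_add, Complex.exp_sub, h]) b (by ring)
  rw [congrFun key a]
  ring

/-- The increment of a continuous logarithm along a loop in the punctured plane is invariant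
under free homotopy. -/
theorem log_increment_eq_of_homotopy (H : C(I × I, ℂ)) (hH : ∀ x, H x ≠ 0)
    (hloop : ∀ s, H (s, 0) = H (s, 1)) (f g : C(I, ℂ))
    (hf : ∀ t, Complex.exp (f t) = H (0, t)) (hg : ∀ t, Complex.exp (g t) = H (1, t)) :
    f 1 - f 0 = g 1 - g 0 := by
  let H' : C(I × I, {z : ℂ // z ≠ 0}) := ⟨fun x ↦ ⟨H x, hH x⟩, by fun_prop⟩
  have hH' : ∀ t, H' (0, t) = (⟨_, (f t).exp_ne_zero⟩ : {z : ℂ // z ≠ 0}) :=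
    fun t ↦ Subtype.ext (hf t).symm
  let L := Complex.isCoveringMap_exp.liftHomotopy H' f hH'
  have hL : ∀ x, Complex.exp (L x) = H x := fun x ↦
    congrArg Subtype.val (congrFun (Complex.isCoveringMap_exp.liftHomotopy_lifts H' f hH') x)
  have hL0 : ∀ t, L (0, t) = f t := Complex.isCoveringMap_exp.liftHomotopy_zero H' f hH'
  have hends := Complex.sub_eq_sub_of_exp_eq_exp (f := fun s ↦ L (s, 1)) (g := fun s ↦ L (s, 0))
    (by fun_prop) (by fun_prop) (fun s ↦ by rw [hL, hL, hloop]) 0 1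
  have hg1 := Complex.sub_eq_sub_of_exp_eq_exp (f := fun t ↦ L (1, t)) (g := g)
    (by fun_prop) (by fun_prop) (fun t ↦ by rw [hL, hg]) 1 0
  simp only [hL0] at hends hg1
  linear_combination hends + hg1

/-- A loop freely homotopic, in the complement of `p`, to a circle around `p` meets every closed
ray issued from `p`. -/
theorem exists_mem_ray_of_homotopy_circle {r : ℝ} {p : ℂ} (hp : ‖p‖ < r) (H : C(I × I, ℂ))
    (hH : ∀ x, H x ≠ p) (hloop : ∀ s, H (s, 0) = H (s, 1))
    (hcircle : ∀ t, H (0, t) = (r : ℂ) * Complex.exp (2 * (π : ℂ) * Complex.I * (t : ℝ)))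
    {v : ℂ} (hv : v ≠ 0) : ∃ t : I, ∃ c : ℝ, 0 ≤ c ∧ H (1, t) = p - c * v := by
  by_contra! hmiss
  have hr : 0 < r := (norm_nonneg p).trans_lt hp
  have hr' : (r : ℂ) ≠ 0 := by exact_mod_cast hr.ne'
  have hcircle_slit : ∀ t : I, 1 - p / r * Complex.exp (-(2 * (π : ℂ) * Complex.I * (t : ℝ))) ∈
      Complex.slitPlane := fun t ↦ by
    rw [sub_eq_add_neg]
    apply Complex.mem_slitPlane_of_norm_lt_one
    have : ‖Complex.exp (-(2 * (π : ℂ) * Complex.I * (t : ℝ)))‖ = 1 := by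
      simp [Complex.norm_exp]
    rw [norm_neg, norm_mul, this, mul_one, norm_div, Complex.norm_real, Real.norm_of_nonneg hr.le]
    exact (div_lt_one hr).2 hp
  have hslit : ∀ t : I, (H (1, t) - p) / v ∈ Complex.slitPlane := fun t ↦ by
    rw [Complex.mem_slitPlane_iff_not_le_zero]
    intro hle
    obtain ⟨hre, him⟩ := Complex.le_def.1 hle
    refine hmiss t (-((H (1, t) - p) / v).re) (by simpa using hre) ?_
    have hreal : (H (1, t) - p) / v = (((H (1, t) - p) / v).re : ℂ) :=
      Complex.ext (by simp) (by simpa using him)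
    push_cast
    rw [← hreal]
    field_simp
    ring
  let f : C(I, ℂ) :=
    ⟨fun t ↦ 2 * (π : ℂ) * Complex.I * (t : ℝ) + Complex.log r +
      Complex.log (1 - p / r * Complex.exp (-(2 * (π : ℂ) * Complex.I * (t : ℝ)))),
      Continuous.add (by fun_prop) (Continuous.clog (by fun_prop) hcircle_slit)⟩
  let g : C(I, ℂ) :=
    ⟨fun t ↦ Complex.log ((H (1, t) - p) / v) + Complex.log v,
      (Continuous.clog (by fun_prop) hslit).add_const _⟩
  have key := log_increment_eq_of_homotopy (H - .const _ p)
    (fun x ↦ by simpa [sub_eq_zero] using hH x) (fun s ↦ by simp [hloop]) f g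
    (fun t ↦ by
      simp only [f, ContinuousMap.coe_mk, ContinuousMap.sub_apply, ContinuousMap.const_apply,
        hcircle, Complex.exp_add, Complex.exp_log hr',
        Complex.exp_log (Complex.slitPlane_ne_zero (hcircle_slit t))]
      rw [Complex.exp_neg]
      field_simp [Complex.exp_ne_zero])
    (fun t ↦ by
      simp only [g, ContinuousMap.coe_mk, ContinuousMap.sub_apply, ContinuousMap.const_apply,
        Complex.exp_add, Complex.exp_log hv,
        Complex.exp_log (Complex.slitPlane_ne_zero (hslit t))]
      field_simp)
  simp [f, g, hloop, Complex.exp_neg, Complex.exp_two_pi_mul_I, Real.pi_ne_zero] at key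

/-- The total variation of a loop is at least twice the distance between any two of its points. -/
theorem two_mul_edist_le_eVariationOn_of_loop {α : Type*} [PseudoEMetricSpace α] (γ : I → α)
    (hγ : γ 0 = γ 1) (s t : I) : 2 * edist (γ s) (γ t) ≤ eVariationOn γ univ := by
  wlog hst : s ≤ t generalizing s t
  · rw [edist_comm]
    exact this t s (le_of_not_ge hst)
  have hsplit : eVariationOn γ univ =
      eVariationOn γ (Icc 0 s) + eVariationOn γ (Icc s t) + eVariationOn γ (Icc t 1) := by
    have h₁ := eVariationOn.Icc_add_Icc γ (s := univ) nonneg' hst (mem_univ s)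
    have h₂ := eVariationOn.Icc_add_Icc γ (s := univ) nonneg' le_one' (mem_univ t)
    simp only [univ_inter] at h₁ h₂
    have huniv : (univ : Set I) = Icc 0 1 := by
      ext x
      simp [le_one']
    rw [huniv]
    exact h₂.symm.trans (congrArg (· + _) h₁.symm)
  calc 2 * edist (γ s) (γ t)
      ≤ edist (γ s) (γ t) + (edist (γ s) (γ 0) + edist (γ 1) (γ t)) := by
        rw [two_mul]
        gcongr
        rw [← hγ]
        exact edist_triangle _ _ _
    _ = edist (γ s) (γ 0) + edist (γ s) (γ t) + edist (γ 1) (γ t) := by ring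
    _ ≤ eVariationOn γ univ := by
        rw [hsplit]
        gcongr
        · exact eVariationOn.edist_le γ ⟨nonneg', le_rfl⟩ ⟨le_rfl, nonneg'⟩
        · exact eVariationOn.edist_le γ ⟨le_rfl, hst⟩ ⟨hst, le_rfl⟩
        · exact eVariationOn.edist_le γ ⟨le_one', le_rfl⟩ ⟨le_rfl, le_one'⟩

/-- **Curves surrounding a compact set `E ⊆ Δ` with two points are uniformly long.**
Let `E ⊆ Δ` be compact containing two distinct points `p, q`, let `X = Δ \ E`, and let
`γ_r (t) = r·e^{2πit}` with `E ⊆ {|z| < r}`, `0 < r < 1`. Then every loop in `X` freely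
homotopic to `γ_r` within `X` has Euclidean length (total variation) at least `2·|p − q|`. -/
theorem length_ge_of_freely_homotopic_to_circle
    (E : Set ℂ) (hE : IsCompact E) (hEΔ : E ⊆ Metric.ball (0:ℂ) 1)
    (p q : ℂ) (hp : p ∈ E) (hq : q ∈ E) (hpq : p ≠ q)
    (r : ℝ) (hr : r ∈ Set.Ioo (0:ℝ) 1) (hEr : E ⊆ Metric.ball (0:ℂ) r)
    (γ' : unitInterval → ℂ) (hγ' : Continuous γ') (hclosed : γ' 0 = γ' 1)
    (hγ'X : ∀ t, γ' t ∈ Metric.ball (0:ℂ) 1 \ E)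
    (hhom : FreelyHomotopicIn
      (fun t => (r : ℂ) * Complex.exp (2 * (π : ℂ) * Complex.I * (t : ℝ)))
      γ' (Metric.ball (0:ℂ) 1 \ E)) :
    ENNReal.ofReal (2 * dist p q) ≤ eVariationOn γ' Set.univ := by
  obtain ⟨H, hH0, hH1, hloop, hHX⟩ := hhom
  have hne : ∀ z ∈ E, ∀ x, H x ≠ z := fun z hz x h ↦ (hHX x).2 (h ▸ hz)
  obtain ⟨t, c, hc, ht⟩ := exists_mem_ray_of_homotopy_circle
    (by simpa using hEr hp) H (hne p hp) hloop hH0 (sub_ne_zero.2 hpq.symm)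
  obtain ⟨s, d, hd, hs⟩ := exists_mem_ray_of_homotopy_circle
    (by simpa using hEr hq) H (hne q hq) hloop hH0 (sub_ne_zero.2 hpq)
  rw [hH1] at ht hs
  have hdist : dist p q ≤ dist (γ' t) (γ' s) := by
    have hdiff : γ' t - γ' s = ((1 + c + d : ℝ) : ℂ) * (p - q) := by
      rw [ht, hs]
      push_cast
      ring
    rw [dist_eq_norm, dist_eq_norm, hdiff, norm_mul, Complex.norm_real,
      Real.norm_of_nonneg (by positivity)]
    exact le_mul_of_one_le_left (norm_nonneg _) (by linarith)
  calc ENNReal.ofReal (2 * dist p q) ≤ ENNReal.ofReal (2 * dist (γ' t) (γ' s)) := by gcongr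
    _ = 2 * edist (γ' t) (γ' s) := by
        rw [ENNReal.ofReal_mul zero_le_two, edist_dist, ENNReal.ofReal_ofNat]
    _ ≤ eVariationOn γ' univ := two_mul_edist_le_eVariationOn_of_loop γ' hclosed t s
end

section
/- Let X be a connected topological 2-manifold (a connected Hausdorff space locally homeomorphic to ℝ²), let E ⊆ X be a finite nonempty subset, and let X₁ be the quotient topological space obtained from X by collapsing E to a single point, with quotient map ρ : X → X₁. Then for every basepoint x₀ ∈ X, the induced homomorphism ρ_* : π₁(X, x₀) → π₁(X₁, ρ(x₀)) between fundamental groups is injective. -/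
/-- The setoid on `X` collapsing the subset `E` to a single point:
`x ~ y` iff `x = y` or both `x, y ∈ E`. -/
def collapseSetoid {X : Type*} (E : Set X) : Setoid X where
  r x y := x = y ∨ (x ∈ E ∧ y ∈ E)
  iseqv := by
    refine ⟨fun x => Or.inl rfl, ?_, ?_⟩
    · rintro x y (rfl | h)
      · exact Or.inl rfl
      · exact Or.inr ⟨h.2, h.1⟩
    · rintro x y z (rfl | h) (rfl | h')
      · exact Or.inl rfl
      · exact Or.inr h'
      · exact Or.inr h
      · exact Or.inr ⟨h.1, h'.2⟩

/-- The quotient space of `X` obtained by collapsing `E ⊆ X` to one point. -/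
def CollapseQuot {X : Type*} (E : Set X) : Type _ := Quotient (collapseSetoid E)

instance {X : Type*} [TopologicalSpace X] (E : Set X) : TopologicalSpace (CollapseQuot E) :=
  instTopologicalSpaceQuotient

/-- The quotient map `ρ : X → X/E`. -/
def collapseMk {X : Type*} (E : Set X) : X → CollapseQuot E := Quotient.mk (collapseSetoid E)

theorem collapseMk_continuous {X : Type*} [TopologicalSpace X] (E : Set X) :
    Continuous (collapseMk E) := continuous_quot_mk
open unitInterval in
/-- A point of a Hausdorff manifold can be pushed along any path by a map homotopic to the identity
which is supported in a prescribed neighborhood of that point. -/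
theorem exists_homotopic_id_apply_eq {V X : Type*} [NormedAddCommGroup V] [NormedSpace ℝ V]
    [ProperSpace V] [TopologicalSpace X] [T2Space X] [ChartedSpace V X]
    {e y : X} (p : Path e y) {U : Set X} (hU : U ∈ nhds e) :
    ∃ f : C(X, X), (ContinuousMap.id X).Homotopic f ∧ f e = y ∧ ∀ x ∉ U, f x = x := by
  classical
  set φ := chartAt V e with hφ
  have hes : e ∈ φ.source := mem_chart_source V e
  obtain ⟨r, hr, hrs⟩ : ∃ r > 0, Metric.closedBall (φ e) r ⊆ φ.target ∩ φ.symm ⁻¹' U := by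
    refine Metric.nhds_basis_closedBall.mem_iff.1 (Filter.inter_mem ?_ ?_)
    · exact φ.open_target.mem_nhds (φ.map_source hes)
    · refine (φ.continuousAt_symm (φ.map_source hes)).preimage_mem_nhds ?_
      rwa [φ.left_inv hes]
  set K : Set X := φ.symm '' Metric.closedBall (φ e) r with hK
  set B : Set X := φ.symm '' Metric.ball (φ e) r with hB
  have hKt : Metric.closedBall (φ e) r ⊆ φ.target := fun z hz => (hrs hz).1
  have hBK : B ⊆ K := Set.image_mono Metric.ball_subset_closedBall
  have hKU : K ⊆ U := by
    rintro _ ⟨z, hz, rfl⟩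
    exact (hrs hz).2
  have hKsource : K ⊆ φ.source := by
    rintro _ ⟨z, hz, rfl⟩
    exact φ.map_target (hKt hz)
  have hKmaps : ∀ x ∈ K, φ x ∈ Metric.closedBall (φ e) r := by
    rintro _ ⟨z, hz, rfl⟩
    rwa [φ.right_inv (hKt hz)]
  have hKclosed : IsClosed K :=
    ((isCompact_closedBall (φ e) r).image_of_continuousOn
      (φ.continuousOn_symm.mono hKt)).isClosed
  have hBopen : IsOpen B :=
    φ.isOpen_image_symm_of_subset_target Metric.isOpen_ball
      (Metric.ball_subset_closedBall.trans hKt)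
  have heK : e ∈ K := ⟨φ e, Metric.mem_closedBall_self hr.le, φ.left_inv hes⟩
  have hsphere : ∀ x ∈ K, x ∉ B → ‖φ x - φ e‖ = r := by
    intro x hx hxB
    have h1 := hKmaps x hx
    rw [mem_closedBall_iff_norm] at h1
    refine le_antisymm h1 (not_lt.1 fun h2 => hxB ⟨φ x, ?_, φ.left_inv (hKsource hx)⟩)
    rwa [mem_ball_iff_norm]
  -- The parameter `m` is at most `-1` where the homotopy is the identity, and nonnegative where
  -- the homotopy runs along `p`.
  let m : I × X → ℝ := fun q => min (2 * (q.1 : ℝ) - 1) (1 - 2 * (‖φ q.2 - φ e‖ / r))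
  let S : I × X → X := fun q => φ.symm (φ e + min 1 (-m q) • (φ q.2 - φ e))
  let P : I × X → X := fun q => p.extend (m q)
  let H : I × X → X := fun q => if q.2 ∈ K then (if 0 ≤ m q then P q else S q) else q.2
  have hφc : ContinuousOn (fun q : I × X => φ q.2) (Prod.snd ⁻¹' K) :=
    φ.continuousOn.comp continuous_snd.continuousOn fun q hq => hKsource hq
  have hmc : ContinuousOn m (Prod.snd ⁻¹' K) := by
    refine ContinuousOn.inf (by fun_prop) (continuousOn_const.sub (continuousOn_const.mul ?_))
    exact (hφc.sub continuousOn_const).norm.div_const r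
  have hPc : ContinuousOn P (Prod.snd ⁻¹' K) := p.continuous_extend.comp_continuousOn hmc
  have hS_mem : ∀ q : I × X, q.2 ∈ K → m q ≤ 0 →
      φ e + min 1 (-m q) • (φ q.2 - φ e) ∈ φ.target := by
    intro q hq hm
    apply hKt
    have h1 := hKmaps _ hq
    rw [mem_closedBall_iff_norm] at h1 ⊢
    rw [add_sub_cancel_left, norm_smul, Real.norm_eq_abs,
      abs_of_nonneg (le_min zero_le_one (by linarith))]
    nlinarith [min_le_left 1 (-m q), norm_nonneg (φ q.2 - φ e)]
  have hS_eq : ∀ q : I × X, q.2 ∈ K → m q ≤ -1 → S q = q.2 := by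
    intro q hq hm
    simp only [S]
    rw [min_eq_left (by linarith), one_smul, add_sub_cancel, φ.left_inv (hKsource hq)]
  have hPS : ∀ q : I × X, m q = 0 → P q = S q := by
    intro q hm
    simp [P, S, hm, φ.left_inv hes]
  have hSc : ContinuousOn S (Prod.snd ⁻¹' K ∩ m ⁻¹' Set.Iic 0) := by
    refine φ.continuousOn_symm.comp ?_ fun q hq => hS_mem q hq.1 hq.2
    have h1 := hmc.mono (Set.inter_subset_left (t := m ⁻¹' Set.Iic 0))
    have h2 := hφc.mono (Set.inter_subset_left (t := m ⁻¹' Set.Iic 0))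
    exact continuousOn_const.add ((continuousOn_const.inf h1.neg).smul (h2.sub continuousOn_const))
  have hsndK : IsClosed (Prod.snd ⁻¹' K : Set (I × X)) := hKclosed.preimage continuous_snd
  have hneg : IsClosed (Prod.snd ⁻¹' K ∩ m ⁻¹' Set.Iic 0) :=
    hmc.preimage_isClosed_of_isClosed hsndK isClosed_Iic
  have hpos : IsClosed (Prod.snd ⁻¹' K ∩ m ⁻¹' Set.Ici 0) :=
    hmc.preimage_isClosed_of_isClosed hsndK isClosed_Ici
  have hout : IsClosed (Prod.snd ⁻¹' Bᶜ : Set (I × X)) :=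
    hBopen.isClosed_compl.preimage continuous_snd
  have hHc : Continuous H := by
    have h1 : ContinuousOn H (Prod.snd ⁻¹' K ∩ m ⁻¹' Set.Iic 0) := by
      refine hSc.congr fun q hq => ?_
      have hq1 : q.2 ∈ K := hq.1
      have hq2 : m q ≤ 0 := hq.2
      simp only [H, if_pos hq1]
      split_ifs with h
      · exact hPS q (le_antisymm hq2 h)
      · rfl
    have h2 : ContinuousOn H (Prod.snd ⁻¹' K ∩ m ⁻¹' Set.Ici 0) := by
      refine (hPc.mono Set.inter_subset_left).congr fun q hq => ?_
      have hq1 : q.2 ∈ K := hq.1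
      have hq2 : 0 ≤ m q := hq.2
      simp only [H, if_pos hq1, if_pos hq2]
    have h3 : ContinuousOn H (Prod.snd ⁻¹' Bᶜ) := by
      refine continuous_snd.continuousOn.congr fun q hq => ?_
      by_cases hqK : q.2 ∈ K
      · have hm : m q ≤ -1 := by
          refine (min_le_right _ _).trans ?_
          rw [hsphere _ hqK hq, div_self hr.ne']
          norm_num
        simp only [H, if_pos hqK, if_neg (show ¬ 0 ≤ m q by linarith)]
        exact hS_eq q hqK hm
      · simp only [H, if_neg hqK]
    rw [← continuousOn_univ]
    refine ((h1.union_of_isClosed h2 hneg hpos).union_of_isClosed h3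
      (hneg.union hpos) hout).mono fun q _ => ?_
    by_cases hqB : q.2 ∈ B
    · rcases le_total (m q) 0 with h | h
      · exact Or.inl (Or.inl ⟨hBK hqB, h⟩)
      · exact Or.inl (Or.inr ⟨hBK hqB, h⟩)
    · exact Or.inr hqB
  refine ⟨⟨fun x => H (1, x), by fun_prop⟩, ⟨⟨⟨H, hHc⟩, fun x => ?_, fun x => rfl⟩⟩, ?_, ?_⟩
  · change H (0, x) = x
    by_cases hx : x ∈ K
    · have hm : m (0, x) ≤ -1 := (min_le_left _ _).trans (by simp)
      simp only [H, if_pos hx, if_neg (show ¬ 0 ≤ m (0, x) by linarith)]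
      exact hS_eq _ hx hm
    · simp only [H, if_neg hx]
  · have hm : m (1, e) = 1 := by simp [m]; norm_num
    change H (1, e) = y
    simp [H, heK, hm, P]
  · intro x hx
    change H (1, x) = x
    simp only [H, if_neg fun h => hx (hKU h)]

/-- Any finite subset of a path-connected Hausdorff manifold can be sent to a single point by a map
homotopic to the identity. -/
theorem exists_homotopic_id_const_on_finite (V : Type*) {X : Type*} [NormedAddCommGroup V]
    [NormedSpace ℝ V] [ProperSpace V] [TopologicalSpace X] [T2Space X] [PathConnectedSpace X]
    [ChartedSpace V X] {E : Set X} (hE : E.Finite) (y : X) :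
    ∃ f : C(X, X), (ContinuousMap.id X).Homotopic f ∧ f y = y ∧ ∀ x ∈ E, f x = y := by
  induction E, hE using Set.Finite.induction_on with
  | empty => exact ⟨.id X, .refl _, rfl, by simp⟩
  | @insert e F heF hF ih =>
    obtain ⟨f, hf, hfy, hfF⟩ := ih
    by_cases hey : e = y
    · refine ⟨f, hf, hfy, ?_⟩
      rintro x (rfl | hx)
      · rw [hey, hfy]
      · exact hfF x hx
    have hU : (insert y F)ᶜ ∈ nhds e :=
      (hF.insert y).isClosed.isOpen_compl.mem_nhds (by simp [hey, heF])
    obtain ⟨g, hg, hge, hgU⟩ :=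
      exists_homotopic_id_apply_eq (V := V) (PathConnectedSpace.somePath e y) hU
    refine ⟨f.comp g, ?_, ?_, ?_⟩
    · simpa using hf.comp hg
    · simp [hgU y (by simp), hfy]
    · rintro x (rfl | hx)
      · simp [hge, hfy]
      · simp [hgU x (by simp [hx]), hfF x hx]

open CategoryTheory in
/-- A map homotopic to the identity is injective on homotopy classes of paths. -/
theorem ContinuousMap.Homotopic.path_homotopic_of_map {X : Type*} [TopologicalSpace X]
    {f : C(X, X)} (hf : (ContinuousMap.id X).Homotopic f) {x y : X} {γ γ' : Path x y}
    (h : (γ.map f.continuous).Homotopic (γ'.map f.continuous)) : γ.Homotopic γ' := by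
  obtain ⟨H⟩ := hf
  have key (p : Path x y) : (Path.Homotopic.Quotient.mk p).trans ⟦H.evalAt y⟧ =
      Path.Homotopic.Quotient.trans ⟦H.evalAt x⟧ ((Path.Homotopic.Quotient.mk p).map f) := by
    have h1 := H.eq_diag_path (X := TopCat.of X) (Y := TopCat.of X)
      (FundamentalGroupoid.fromPath (.mk p))
    have h2 : (Path.Homotopic.Quotient.mk p).map (ContinuousMap.id X) = .mk p := rfl
    exact h2 ▸ h1.1.trans h1.2.symm
  have h1 : (Path.Homotopic.Quotient.mk γ).map f = (Path.Homotopic.Quotient.mk γ').map f :=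
    Quotient.sound h
  rw [← FundamentalGroupoid.fromPath_eq_iff_homotopic]
  have h2 := (key γ).trans ((congrArg _ h1).trans (key γ').symm)
  exact (cancel_mono (FundamentalGroupoid.fromPath ⟦H.evalAt y⟧)).1 h2

/-- **Collapsing a finite set to a point is `π₁`-injective.**
Let `X` be a connected topological 2-manifold, `E ⊆ X` finite and nonempty, and
`ρ : X → X₁` the quotient map collapsing `E` to a point. Then the induced homomorphism
`ρ_* : π₁(X, x₀) → π₁(X₁, ρ x₀)` is injective; equivalently, two loops at `x₀` whose images
under `ρ` are homotopic (rel endpoints) in `X₁` are already homotopic in `X`. -/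
theorem collapse_finite_set_pi1_injective
    {X : Type*} [TopologicalSpace X] [T2Space X] [ConnectedSpace X]
    [ChartedSpace (EuclideanSpace ℝ (Fin 2)) X]
    (E : Set X) (hEfin : E.Finite) (hEne : E.Nonempty) (x₀ : X) :
    ∀ γ γ' : Path x₀ x₀,
      (γ.map (collapseMk_continuous E)).Homotopic (γ'.map (collapseMk_continuous E)) →
      γ.Homotopic γ' := by
  intro γ γ' h
  have : LocallyPathConnectedSpace X :=
    ChartedSpace.locallyPathConnectedSpace (EuclideanSpace ℝ (Fin 2)) X
  have : PathConnectedSpace X := pathConnectedSpace_iff_connectedSpace.2 inferInstance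
  obtain ⟨y, -⟩ := hEne
  obtain ⟨f, hf, -, hfE⟩ :=
    exists_homotopic_id_const_on_finite (EuclideanSpace ℝ (Fin 2)) hEfin y
  let r : C(CollapseQuot E, X) :=
    ⟨Quotient.lift f fun a b hab => by
      rcases hab with rfl | ⟨ha, hb⟩
      · rfl
      · rw [hfE a ha, hfE b hb], f.continuous.quotient_lift _⟩
  exact hf.path_homotopic_of_map (h.map r)
end

section
/- Let X be a connected topological 2-manifold (a connected Hausdorff space locally homeomorphic to ℝ²), let E ⊆ X be a finite subset, and let X₁ be the quotient topological space obtained from X by collapsing E to a single point, with quotient map ρ : X → X₁. If γ : [0,1] → X is a continuous path such that γ(0) and γ(1) are two distinct points of E, then the loop ρ ∘ γ in X₁ (which is closed, since ρ(γ(0)) = ρ(γ(1))) is not null-homotopic in X₁. -/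
theorem collapseMk_eq_of_mem {X : Type*} (E : Set X) {a b : X} (ha : a ∈ E) (hb : b ∈ E) :
    collapseMk E a = collapseMk E b := Quotient.sound (Or.inr ⟨ha, hb⟩)

/-- If a covering map sends two paths with a common source to paths that are homotopic relative to
the endpoints, then the two paths have the same target. -/
theorem IsCoveringMap.apply_one_eq_of_comp_homotopicRel {Y Z : Type*} [TopologicalSpace Y]
    [TopologicalSpace Z] {p : Y → Z} (cov : IsCoveringMap p) {f₀ f₁ : C(unitInterval, Y)}
    (h0 : f₀ 0 = f₁ 0)
    (h : (ContinuousMap.comp ⟨p, cov.continuous⟩ f₀).HomotopicRel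
      (.comp ⟨p, cov.continuous⟩ f₁) {0, 1}) :
    f₀ 1 = f₁ 1 := by
  obtain ⟨F⟩ := (cov.homotopicRel_iff_comp ⟨0, by simp, h0⟩).2 h
  exact F.fst_eq_snd (by simp)

/-- In a locally compact Hausdorff space, a point of a finite set can be separated from the other
points of that set by a continuous real function. -/
theorem exists_continuous_eq_zero_eq_one_of_finite {X : Type*} [TopologicalSpace X] [T2Space X]
    [LocallyCompactSpace X] {E : Set X} (hE : E.Finite) (a : X) :
    ∃ f : C(X, ℝ), f a = 0 ∧ ∀ x ∈ E, x ≠ a → f x = 1 := by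
  obtain ⟨f, hf0, hf1, -⟩ := exists_continuous_zero_one_of_isCompact
    (isCompact_singleton (x := a)) (hE.subset (Set.sdiff_subset (t := {a}))).isClosed
    Set.disjoint_sdiff_right
  exact ⟨f, hf0 rfl, fun x hx hxa => hf1 ⟨hx, hxa⟩⟩

/-- A continuous map that is constant on `E` descends to the quotient collapsing `E`. -/
def collapseLift {X Y : Type*} [TopologicalSpace X] [TopologicalSpace Y] {E : Set X} (g : C(X, Y))
    (hg : ∀ x ∈ E, ∀ y ∈ E, g x = g y) : C(CollapseQuot E, Y) where
  toFun := Quotient.lift g fun x y h => h.elim (congrArg g) fun hxy => hg x hxy.1 y hxy.2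
  continuous_toFun := g.continuous.quotient_lift _

/-- **A path between two distinct collapsed points gives a nontrivial loop.**
Let `X` be a connected topological 2-manifold, `E ⊆ X` finite, and `ρ : X → X₁` the quotient
map collapsing `E` to a point. If `γ : [0,1] → X` is a continuous path whose endpoints are two
distinct points of `E`, then the closed loop `ρ ∘ γ` is not null-homotopic in `X₁`. -/
theorem collapse_path_between_distinct_points_not_nullhomotopic
    {X : Type*} [TopologicalSpace X] [T2Space X] [ConnectedSpace X]
    [ChartedSpace (EuclideanSpace ℝ (Fin 2)) X]
    (E : Set X) (hEfin : E.Finite)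
    {a b : X} (ha : a ∈ E) (hb : b ∈ E) (hab : a ≠ b)
    (γ : Path a b) :
    ¬ ((γ.map (collapseMk_continuous E)).cast rfl
        (collapseMk_eq_of_mem E ha hb)).Homotopic (Path.refl (collapseMk E a)) := by
  have : LocallyCompactSpace X := ChartedSpace.locallyCompactSpace (EuclideanSpace ℝ (Fin 2)) X
  obtain ⟨f, hfa, hf⟩ := exists_continuous_eq_zero_eq_one_of_finite hEfin a
  have cov := AddCircle.isCoveringMap_coe (1 : ℝ)
  let g : C(X, AddCircle (1 : ℝ)) := .comp ⟨_, cov.continuous⟩ f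
  have hg0 : ∀ x ∈ E, g x = 0 := fun x hx => by
    change ((f x : ℝ) : AddCircle (1 : ℝ)) = 0
    by_cases hxa : x = a
    · simp [hxa, hfa]
    · rw [hf x hx hxa, AddCircle.coe_period]
  let G : C(CollapseQuot E, AddCircle (1 : ℝ)) :=
    collapseLift g fun x hx y hy => (hg0 x hx).trans (hg0 y hy).symm
  rintro ⟨F⟩
  have key := cov.apply_one_eq_of_comp_homotopicRel (f₀ := f.comp γ)
    (f₁ := .const unitInterval (f a)) (by simp) ⟨F.compContinuousMap G⟩
  have h01 : f b = f a := by simpa using key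
  rw [hfa, hf b hb hab.symm] at h01
  exact one_ne_zero h01
end

section
/- Let E be a finite-dimensional real normed vector space, and let K ⊆ K' ⊆ E be compact subsets such that K is connected and K is contained in the interior of K'. Let f_n : E → E be a sequence of continuously differentiable maps with sup_{x ∈ K'} ‖f_n(x) − x‖ → 0 and sup_{x ∈ K'} ‖Df_n(x) − id‖ → 0 as n → ∞. Then there exists N such that for every n ≥ N there is a unique map g_n : K → K' satisfying f_n(g_n(y)) = y for all y ∈ K. -/
open Metric Set in
/-- A map that is `C¹`-close to the identity on a closed ball takes the value at the centre
exactly once on that ball. -/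
theorem existsUnique_mem_closedBall_eq_center
    {E : Type*} [NormedAddCommGroup E] [NormedSpace ℝ E] [CompleteSpace E]
    {f : E → E} {y : E} {δ : ℝ} (hδ : 0 ≤ δ)
    (hf : ∀ x ∈ closedBall y δ, DifferentiableAt ℝ f x)
    (h0 : ∀ x ∈ closedBall y δ, ‖f x - x‖ ≤ δ)
    (h1 : ∀ x ∈ closedBall y δ, ‖fderiv ℝ f x - ContinuousLinearMap.id ℝ E‖ ≤ 1 / 2) :
    ∃! x, x ∈ closedBall y δ ∧ f x = y := by
  have hlip : LipschitzOnWith (1 / 2) (fun x => y - (f x - x)) (closedBall y δ) := by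
    refine (convex_closedBall y δ).lipschitzOnWith_of_nnnorm_hasFDerivWithin_le
      (f' := fun x => -(fderiv ℝ f x - ContinuousLinearMap.id ℝ E)) (fun x hx => ?_)
      (fun x hx => ?_)
    · exact (((hf x hx).hasFDerivAt.sub (hasFDerivAt_id x)).const_sub y).hasFDerivWithinAt
    · rw [nnnorm_neg, ← NNReal.coe_le_coe]
      simpa using h1 x hx
  have hmaps : MapsTo (fun x => y - (f x - x)) (closedBall y δ) (closedBall y δ) := by
    intro x hx
    simpa [mem_closedBall, dist_eq_norm, norm_sub_rev] using h0 x hx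
  have hcontr : ContractingWith (1 / 2) (hmaps.restrict _ _ _) :=
    ⟨by rw [← NNReal.coe_lt_coe]; norm_num, hlip.mapsToRestrict hmaps⟩
  obtain ⟨x, hx, hfix, -⟩ := hcontr.exists_fixedPoint' isClosed_closedBall.isComplete hmaps
    (mem_closedBall_self hδ) (edist_ne_top _ _)
  have hfix' : y - (f x - x) = x := hfix
  have hfx : f x = y := by
    rw [sub_eq_iff_eq_add, add_sub_cancel] at hfix'
    exact hfix'.symm
  refine ⟨x, ⟨hx, hfx⟩, fun z hz => ?_⟩
  have h := hlip.dist_le_mul z hz.1 x hx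
  simp only [hz.2, hfx, sub_sub_cancel] at h
  norm_num at h
  exact dist_le_zero.mp (by linarith)


/-- **Existence and uniqueness of local inverses of maps `C¹`-close to the identity.**
Let `E` be a finite-dimensional real normed vector space, `K ⊆ K'` compact with `K` connected
and contained in the interior of `K'`, and `f_n : E → E` a sequence of `C¹` maps converging
to the identity in the `C¹` sense on `K'`. Then for all large `n` there is a unique map
`g_n : K → K'` with `f_n ∘ g_n = id_K`. -/
theorem existsUnique_inverse_of_C1_close_to_id
    {E : Type*} [NormedAddCommGroup E] [NormedSpace ℝ E] [FiniteDimensional ℝ E]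
    (K K' : Set E) (hK : IsCompact K) (hK' : IsCompact K')
    (hKconn : IsConnected K) (hKK' : K ⊆ interior K')
    (f : ℕ → E → E) (hf : ∀ n, ContDiff ℝ 1 (f n))
    (hC0 : ∀ ε > 0, ∃ N : ℕ, ∀ n ≥ N, ∀ x ∈ K', ‖f n x - x‖ < ε)
    (hC1 : ∀ ε > 0, ∃ N : ℕ, ∀ n ≥ N, ∀ x ∈ K',
      ‖fderiv ℝ (f n) x - ContinuousLinearMap.id ℝ E‖ < ε) :
    ∃ N : ℕ, ∀ n ≥ N, ∃! g : K → K', ∀ y : K, f n (g y : E) = (y : E) := by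
  obtain ⟨δ, hδ, hδK⟩ := hK.exists_cthickening_subset_open isOpen_interior hKK'
  have hball : ∀ y ∈ K, Metric.closedBall y δ ⊆ K' := fun y hy =>
    (Metric.closedBall_subset_cthickening hy δ).trans (hδK.trans interior_subset)
  obtain ⟨N₀, hN₀⟩ := hC0 δ hδ
  obtain ⟨N₁, hN₁⟩ := hC1 (1 / 2) (by norm_num)
  refine ⟨max N₀ N₁, fun n hn => ?_⟩
  have h0 := hN₀ n (le_of_max_le_left hn)
  have h1 := hN₁ n (le_of_max_le_right hn)
  have key : ∀ y : K, ∃! x : K', f n x = y := by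
    intro y
    have hy := hball y y.2
    obtain ⟨x, ⟨hx, hfx⟩, huniq⟩ := existsUnique_mem_closedBall_eq_center hδ.le
      (fun x _ => (hf n).differentiable one_ne_zero x) (fun x hx => (h0 x (hy hx)).le)
      (fun x hx => (h1 x (hy hx)).le)
    refine ⟨⟨x, hy hx⟩, hfx, fun z hz => Subtype.ext (huniq z ⟨?_, hz⟩)⟩
    have hz0 := (h0 z z.2).le
    rw [hz] at hz0
    rwa [Metric.mem_closedBall, dist_eq_norm, norm_sub_rev]
  choose g hg huniq using key
  exact ⟨g, hg, fun g' hg' => funext fun y => huniq y _ (hg' y)⟩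
end
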